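/- Let f_1, f_2 : [0,1] → [0,1] be the contractions f_1(x) = x/2 and f_2(x) = 3x/4, and define F : 𝔉(I) → 𝔉(I) by F(w)(x) = max(f̃_1(w)(x), f̃_2(w)(x)) (so that [F(w)]_α = [f̃_1(w)]_α ∪ [f̃_2(w)]_α for all α ∈ [0,1]). Then for the fuzzy sets u, v of the Example, d_0(F(u), F(v)) ≥ 1/4 = d_0(u, v); in particular, F : (𝔉(I), d_0) → (𝔉(I), d_0) is not a contraction. -/

import Mathlib

open Set Metric Filter
open scoped Classical

noncomputable section

/-- The `α`-cut `[u]_α = {x | u x ≥ α}` of a fuzzy set for `α ∈ (0,1]`,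
and its support `[u]_0 = closure {x | u x > 0}` for `α = 0`. -/
def fcut {X : Type*} [TopologicalSpace X] (u : X → ℝ) (α : ℝ) : Set X :=
  if α = 0 then closure {x | 0 < u x} else {x | α ≤ u x}

/-- `u ∈ 𝔉(X)`: an upper semicontinuous fuzzy set (with values in `[0,1]`)
whose support is compact and whose `1`-cut is nonempty. -/
def IsFuzzy {X : Type*} [TopologicalSpace X] (u : X → ℝ) : Prop :=
  UpperSemicontinuous u ∧ (∀ x, u x ∈ Icc (0 : ℝ) 1) ∧
    IsCompact (fcut u 0) ∧ (fcut u 1).Nonempty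

/-- The level-wise metric `d_∞(u,v) = sup{d_H([u]_α, [v]_α) : α ∈ [0,1]}`. -/
def dInfty {X : Type*} [MetricSpace X] (u v : X → ℝ) : ℝ :=
  ⨆ α : Icc (0 : ℝ) 1, hausdorffDist (fcut u α.1) (fcut v α.1)

/-- `t ∈ Hom(I)`: a strictly increasing homeomorphism of `I = [0,1]` onto itself
(recorded as a map `ℝ → ℝ`, considered on `[0,1]`). -/
def IsHomI (t : ℝ → ℝ) : Prop :=
  StrictMonoOn t (Icc 0 1) ∧ ContinuousOn t (Icc 0 1) ∧
    MapsTo t (Icc 0 1) (Icc 0 1) ∧ SurjOn t (Icc 0 1) (Icc 0 1)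

/-- The Skorokhod metric
`d_0(u,v) = inf{ε > 0 : ∃ t ∈ Hom(I), sup_{x ∈ I} |t x - x| ≤ ε and d_∞(u, t∘v) ≤ ε}`. -/
def dSk {X : Type*} [MetricSpace X] (u v : X → ℝ) : ℝ :=
  sInf {ε : ℝ | 0 < ε ∧ ∃ t : ℝ → ℝ, IsHomI t ∧
    (∀ x ∈ Icc (0 : ℝ) 1, |t x - x| ≤ ε) ∧ dInfty u (t ∘ v) ≤ ε}

/-- Zadeh's extension of `f`: `f̃(u)(x) = sup{u z : z ∈ f⁻¹(x)}`, which is `0`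
when `f⁻¹(x) = ∅` since `sSup ∅ = 0` in `ℝ`. -/
def zadeh {X : Type*} (f : X → X) (u : X → ℝ) : X → ℝ :=
  fun x => sSup (u '' (f ⁻¹' {x}))

/-- The unit interval `I = [0,1]` as a metric space. -/
abbrev I01 : Type := Set.Icc (0 : ℝ) 1

/-- `a_n = 1 - (5/8)/2^n` (so `a_0 = 3/8`). -/
def aSeq (n : ℕ) : ℝ := 1 - 5 / 8 / 2 ^ n

/-- `a'_0 = 3/8` and `a'_n = 1 - (1/4)/2^n` for `n ≥ 1` (so `a'_1 = 7/8`). -/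
def aSeq' (n : ℕ) : ℝ := if n = 0 then 3 / 8 else 1 - 1 / 4 / 2 ^ n

/-- `b'_0 = 1/8` and `b'_n = a'_n` for `n ≥ 1`. -/
def bSeq' (n : ℕ) : ℝ := if n = 0 then 1 / 8 else aSeq' n

/-- `u(x) = 0` on `[0, 3/8)`, `u(x) = a_n` on `[a'_n, a'_{n+1})`, and `u(1) = 1`. -/
def uAux (x : ℝ) : ℝ :=
  if x = 1 then 1
  else if h : ∃ n : ℕ, aSeq' n ≤ x ∧ x < aSeq' (n + 1) then aSeq h.choose
  else 0

/-- `v(x) = 0` on `[0, 1/8)`, `v(x) = 1/8` on `[1/8, 7/8)`, `v(x) = 5/8` on `[7/8, 15/16)`,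
`v(x) = a_{n-1}` on `[b'_n, b'_{n+1})` for `n ≥ 2`, and `v(1) = 1`. -/
def vAux (x : ℝ) : ℝ :=
  if x = 1 then 1
  else if x < 1 / 8 then 0
  else if x < 7 / 8 then 1 / 8
  else if x < 15 / 16 then 5 / 8
  else if h : ∃ n : ℕ, 2 ≤ n ∧ bSeq' n ≤ x ∧ x < bSeq' (n + 1) then aSeq (h.choose - 1)
  else 0

/-- The fuzzy set `u` of the Example, as a function on `I = [0,1]`. -/
def uEx : I01 → ℝ := fun x => uAux x.1

/-- The fuzzy set `v` of the Example, as a function on `I = [0,1]`. -/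
def vEx : I01 → ℝ := fun x => vAux x.1

/-- The contraction `f₁(x) = x/2` on `[0,1]`. -/
def f1Ex : I01 → I01 := fun x =>
  ⟨x.1 / 2, ⟨by have h := x.2.1; linarith, by have h := x.2.2; linarith⟩⟩

/-- The contraction `f₂(x) = 3x/4` on `[0,1]`. -/
def f2Ex : I01 → I01 := fun x =>
  ⟨3 * x.1 / 4, ⟨by have h := x.2.1; linarith, by have h := x.2.2; linarith⟩⟩

/-- `F(w)(x) = max(f̃₁(w)(x), f̃₂(w)(x))`. -/
def FEx (w : I01 → ℝ) : I01 → ℝ := fun x => max (zadeh f1Ex w x) (zadeh f2Ex w x)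

theorem aSeq_mono : Monotone aSeq := by
  refine monotone_nat_of_le_succ fun n => ?_
  have h : (0 : ℝ) < 2 ^ n := by positivity
  have h' : 5 / 8 / 2 ^ (n + 1) = 5 / 8 / (2 : ℝ) ^ n / 2 := by rw [pow_succ]; field_simp
  have h'' : (0 : ℝ) < 5 / 8 / 2 ^ n := by positivity
  unfold aSeq
  linarith

theorem aSeq_ge (n : ℕ) : 3 / 8 ≤ aSeq n := by
  have h := aSeq_mono (Nat.zero_le n)
  norm_num [aSeq] at h ⊢
  linarith

theorem aSeq_le_one (n : ℕ) : aSeq n ≤ 1 := by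
  have h : (0 : ℝ) < 5 / 8 / 2 ^ n := by positivity
  unfold aSeq
  linarith

theorem aSeq'_mono : Monotone aSeq' := by
  refine monotone_nat_of_le_succ fun n => ?_
  rcases n with _ | n
  · norm_num [aSeq']
  · have h' : 1 / 4 / 2 ^ (n + 1 + 1) = 1 / 4 / (2 : ℝ) ^ (n + 1) / 2 := by
      rw [pow_succ _ (n + 1)]; field_simp
    have h'' : (0 : ℝ) < 1 / 4 / 2 ^ (n + 1) := by positivity
    simp only [aSeq', Nat.add_eq_zero_iff, one_ne_zero, and_false, if_false]
    linarith

theorem aSeq'_lt_one (n : ℕ) : aSeq' n < 1 := by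
  have h : (0 : ℝ) < 1 / 4 / 2 ^ n := by positivity
  unfold aSeq'
  split_ifs <;> linarith

theorem exists_lt_aSeq' {x : ℝ} (hx : x < 1) : ∃ n : ℕ, x < aSeq' (n + 1) := by
  obtain ⟨n, hn⟩ := exists_pow_lt_of_lt_one (sub_pos.2 hx) (by norm_num : (1 / 2 : ℝ) < 1)
  refine ⟨n, ?_⟩
  have h : 1 / 4 / (2 : ℝ) ^ (n + 1) = (1 / 2) ^ n / 8 := by
    rw [pow_succ, one_div_pow]; field_simp; norm_num
  have h' : (0 : ℝ) < (1 / 2) ^ n := by positivity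
  simp only [aSeq', Nat.add_eq_zero_iff, one_ne_zero, and_false, if_false]
  linarith

theorem exists_mem_Ico_aSeq' {x : ℝ} {k : ℕ} (hk : aSeq' k ≤ x) (hx : x < 1) :
    ∃ n : ℕ, k ≤ n ∧ aSeq' n ≤ x ∧ x < aSeq' (n + 1) := by
  classical
  have hex := exists_lt_aSeq' hx
  have hlt := Nat.find_spec hex
  have hkn : k ≤ Nat.find hex := by
    by_contra! h
    exact absurd (hlt.trans_le (aSeq'_mono h)) hk.not_gt
  refine ⟨Nat.find hex, hkn, ?_, hlt⟩
  rcases hn : Nat.find hex with _ | m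
  · rw [hn, Nat.le_zero] at hkn
    exact hkn ▸ hk
  · exact not_lt.1 (Nat.find_min hex (hn ▸ Nat.lt_succ_self m))

theorem uAux_le {x : ℝ} {n : ℕ} (hx : x < aSeq' (n + 1)) : uAux x ≤ aSeq n := by
  have h1 := aSeq'_lt_one (n + 1)
  have h0 := aSeq_ge n
  unfold uAux
  split_ifs with h h'
  · linarith
  · refine aSeq_mono (Nat.lt_succ_iff.1 ?_)
    by_contra! hlt
    exact absurd (h'.choose_spec.1.trans_lt hx) (aSeq'_mono hlt).not_gt
  · linarith

theorem uAux_eq {x : ℝ} {n : ℕ} (h1 : aSeq' n ≤ x) (h2 : x < aSeq' (n + 1)) :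
    uAux x = aSeq n := by
  refine (uAux_le h2).antisymm ?_
  have hx : x ≠ 1 := (h2.trans (aSeq'_lt_one _)).ne
  have h : ∃ n : ℕ, aSeq' n ≤ x ∧ x < aSeq' (n + 1) := ⟨n, h1, h2⟩
  rw [uAux, if_neg hx, dif_pos h]
  refine aSeq_mono (Nat.lt_succ_iff.1 ?_)
  by_contra! hlt
  exact absurd (h1.trans_lt h.choose_spec.2) (aSeq'_mono hlt).not_gt

theorem uAux_one : uAux 1 = 1 := if_pos rfl

theorem uAux_eq_zero {x : ℝ} (hx : x < 3 / 8) : uAux x = 0 := by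
  rw [uAux, if_neg (by linarith), dif_neg]
  rintro ⟨n, hn, -⟩
  have h : aSeq' 0 ≤ aSeq' n := aSeq'_mono (Nat.zero_le n)
  simp only [aSeq', if_true] at h hn
  linarith

theorem uAux_mem (x : ℝ) : uAux x ∈ Icc (0 : ℝ) 1 := by
  unfold uAux
  split_ifs with h h'
  · simp
  · exact ⟨by linarith [aSeq_ge h'.choose], aSeq_le_one _⟩
  · simp

theorem le_of_uAux_pos {x : ℝ} (hx : 0 < uAux x) : 3 / 8 ≤ x := by
  by_contra! h
  exact hx.ne' (uAux_eq_zero h)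

theorem le_uAux {x : ℝ} (hx : 3 / 8 ≤ x) (hx1 : x ≤ 1) : 3 / 8 ≤ uAux x := by
  rcases hx1.eq_or_lt with rfl | hlt
  · norm_num [uAux_one]
  · obtain ⟨n, -, h1, h2⟩ := exists_mem_Ico_aSeq' (k := 0) (by simpa [aSeq'] using hx) hlt
    exact uAux_eq h1 h2 ▸ aSeq_ge n

theorem le_of_lt_uAux {x : ℝ} (hx : 3 / 8 < uAux x) : 7 / 8 ≤ x := by
  by_contra! h
  have h' := uAux_le (n := 0) (x := x) (by norm_num [aSeq']; linarith)
  norm_num [aSeq] at h'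
  linarith

theorem bSeq'_eq {n : ℕ} (hn : n ≠ 0) : bSeq' n = aSeq' n := if_neg hn

theorem aSeq'_two : aSeq' 2 = 15 / 16 := by norm_num [aSeq']

theorem aSeq_one : aSeq 1 = 11 / 16 := by norm_num [aSeq]

theorem vAux_le {x : ℝ} {n : ℕ} (hn : 2 ≤ n) (hx : x < aSeq' (n + 1)) :
    vAux x ≤ aSeq (n - 1) := by
  have h1 := aSeq'_lt_one (n + 1)
  have h0 : aSeq 1 ≤ aSeq (n - 1) := aSeq_mono (by omega)
  rw [aSeq_one] at h0
  unfold vAux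
  split_ifs with _ _ _ _ h'
  any_goals linarith
  refine aSeq_mono (Nat.sub_le_sub_right (Nat.lt_succ_iff.1 ?_) 1)
  by_contra! hlt
  have hc := h'.choose_spec
  rw [bSeq'_eq (by omega)] at hc
  exact absurd (hc.2.1.trans_lt hx) (aSeq'_mono hlt).not_gt

theorem vAux_eq {x : ℝ} {n : ℕ} (hn : 2 ≤ n) (h1 : aSeq' n ≤ x) (h2 : x < aSeq' (n + 1)) :
    vAux x = aSeq (n - 1) := by
  refine (vAux_le hn h2).antisymm ?_
  have hx : x ≠ 1 := (h2.trans (aSeq'_lt_one _)).ne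
  have h15 : 15 / 16 ≤ x := aSeq'_two ▸ (aSeq'_mono hn).trans h1
  have h : ∃ n : ℕ, 2 ≤ n ∧ bSeq' n ≤ x ∧ x < bSeq' (n + 1) :=
    ⟨n, hn, by rwa [bSeq'_eq (by omega)], by rwa [bSeq'_eq (by omega)]⟩
  rw [vAux, if_neg hx, if_neg (by linarith), if_neg (by linarith), if_neg (by linarith), dif_pos h]
  refine aSeq_mono (Nat.sub_le_sub_right (Nat.lt_succ_iff.1 ?_) 1)
  by_contra! hlt
  have hc := h.choose_spec.2.2
  rw [bSeq'_eq (by omega)] at hc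
  exact absurd (h1.trans_lt hc) (aSeq'_mono hlt).not_gt

theorem vAux_one : vAux 1 = 1 := if_pos rfl

theorem vAux_mem (x : ℝ) : vAux x ∈ Icc (0 : ℝ) 1 := by
  unfold vAux
  split_ifs with _ _ _ _ h'
  any_goals norm_num
  exact ⟨by linarith [aSeq_ge (h'.choose - 1)], aSeq_le_one _⟩

theorem vAux_eq_zero {x : ℝ} (hx : x < 1 / 8) : vAux x = 0 := by
  rw [vAux, if_neg (by linarith), if_pos hx]

theorem vAux_le_eighth {x : ℝ} (hx : x < 7 / 8) : vAux x ≤ 1 / 8 := by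
  rw [vAux, if_neg (by linarith), if_pos hx]
  split_ifs <;> norm_num

theorem vAux_le_five_eighths {x : ℝ} (hx : x < 15 / 16) : vAux x ≤ 5 / 8 := by
  rw [vAux, if_neg (by linarith), if_pos hx]
  split_ifs <;> norm_num

theorem le_of_vAux_pos {x : ℝ} (hx : 0 < vAux x) : 1 / 8 ≤ x := by
  by_contra! h
  exact hx.ne' (vAux_eq_zero h)

theorem le_of_lt_vAux {x : ℝ} (hx : 1 / 8 < vAux x) : 7 / 8 ≤ x := by
  by_contra! h
  exact hx.not_ge (vAux_le_eighth h)

theorem le_vAux {x : ℝ} (hx : 1 / 8 ≤ x) (hx1 : x ≤ 1) : 1 / 8 ≤ vAux x := by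
  rcases hx1.eq_or_lt with rfl | hlt
  · norm_num [vAux_one]
  · by_cases h15 : 15 / 16 ≤ x
    · obtain ⟨n, hn, h1, h2⟩ := exists_mem_Ico_aSeq' (aSeq'_two.trans_le h15) hlt
      rw [vAux_eq hn h1 h2]
      linarith [aSeq_ge (n - 1)]
    · rw [vAux, if_neg hlt.ne, if_neg hx.not_gt, if_pos (not_le.1 h15)]
      split_ifs <;> norm_num

/-- A function on `I` whose values do not exceed `f x` on some left ray containing a
neighbourhood of `x`, for every `x`, is upper semicontinuous. -/
theorem upperSemicontinuous_of_forall_exists {f : ℝ → ℝ}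
    (hf : ∀ x ≤ (1 : ℝ), ∃ c > x, ∀ y ≤ (1 : ℝ), y < c → f y ≤ f x) :
    UpperSemicontinuous fun x : I01 => f x.1 := by
  intro x r hr
  obtain ⟨c, hc, h⟩ := hf x.1 x.2.2
  filter_upwards [(isOpen_lt continuous_subtype_val continuous_const).mem_nhds
    (show x.1 < c from hc)] with y hy
  exact (h y.1 y.2.2 hy).trans_lt hr

theorem isFuzzy_of_forall_exists {f : ℝ → ℝ} (hf0 : ∀ x, f x ∈ Icc (0 : ℝ) 1) (hf1 : f 1 = 1)
    (hf : ∀ x ≤ (1 : ℝ), ∃ c > x, ∀ y ≤ (1 : ℝ), y < c → f y ≤ f x) :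
    IsFuzzy fun x : I01 => f x.1 := by
  refine ⟨upperSemicontinuous_of_forall_exists hf, fun x => hf0 _, ?_, ⟨1, by simp⟩, ?_⟩
  · rw [fcut, if_pos rfl]
    exact isClosed_closure.isCompact
  · rw [fcut, if_neg one_ne_zero]
    exact hf1.ge

theorem isFuzzy_uEx : IsFuzzy uEx := by
  refine isFuzzy_of_forall_exists uAux_mem uAux_one fun x hx => ?_
  rcases hx.eq_or_lt with rfl | hlt
  · exact ⟨2, by norm_num, fun y _ _ => (uAux_mem y).2.trans_eq uAux_one.symm⟩
  by_cases h : x < 3 / 8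
  · exact ⟨3 / 8, h, fun y _ hy => (uAux_eq_zero hy).trans_le (uAux_mem x).1⟩
  · obtain ⟨n, -, h1, h2⟩ := exists_mem_Ico_aSeq' (k := 0) (by simpa [aSeq'] using h) hlt
    exact ⟨_, h2, fun y _ hy => uAux_eq h1 h2 ▸ uAux_le hy⟩

theorem isFuzzy_vEx : IsFuzzy vEx := by
  refine isFuzzy_of_forall_exists vAux_mem vAux_one fun x hx => ?_
  rcases hx.eq_or_lt with rfl | hlt
  · exact ⟨2, by norm_num, fun y _ _ => (vAux_mem y).2.trans_eq vAux_one.symm⟩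
  by_cases h : x < 1 / 8
  · exact ⟨1 / 8, h, fun y _ hy => (vAux_eq_zero hy).trans_le (vAux_mem x).1⟩
  by_cases h' : x < 7 / 8
  · exact ⟨7 / 8, h', fun y _ hy => (vAux_le_eighth hy).trans (le_vAux (not_lt.1 h) hx)⟩
  by_cases h'' : x < 15 / 16
  · refine ⟨15 / 16, h'', fun y _ hy => (vAux_le_five_eighths hy).trans_eq ?_⟩
    rw [vAux, if_neg hlt.ne, if_neg h, if_neg h', if_pos h'']
  · obtain ⟨n, hn, h1, h2⟩ := exists_mem_Ico_aSeq' (aSeq'_two.trans_le (not_lt.1 h'')) hlt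
    exact ⟨_, h2, fun y _ hy => vAux_eq hn h1 h2 ▸ vAux_le hn hy⟩

theorem dist_I01_le_one (x y : I01) : dist x y ≤ 1 := by
  rw [Subtype.dist_eq, Real.dist_eq, abs_le]
  constructor <;> linarith [x.2.1, x.2.2, y.2.1, y.2.2]

theorem hausdorffDist_I01_le_one (s t : Set I01) : hausdorffDist s t ≤ 1 := by
  rcases s.eq_empty_or_nonempty with rfl | ⟨x, hx⟩
  · simp [hausdorffDist_empty']
  rcases t.eq_empty_or_nonempty with rfl | ⟨y, hy⟩
  · simp [hausdorffDist_empty]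
  exact hausdorffDist_le_of_mem_dist zero_le_one (fun z _ => ⟨y, hy, dist_I01_le_one z y⟩)
    fun z _ => ⟨x, hx, dist_I01_le_one z x⟩

theorem hausdorffDist_le_dInfty (u v : I01 → ℝ) {α : ℝ} (hα : α ∈ Icc (0 : ℝ) 1) :
    hausdorffDist (fcut u α) (fcut v α) ≤ dInfty u v :=
  le_ciSup (f := fun α : Icc (0 : ℝ) 1 => hausdorffDist (fcut u α.1) (fcut v α.1))
    ⟨1, by rintro _ ⟨β, rfl⟩; exact hausdorffDist_I01_le_one _ _⟩ ⟨α, hα⟩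

theorem le_hausdorffDist_I01 {s t : Set I01} {x : I01} {r : ℝ} (hx : x ∈ s) (ht : t.Nonempty)
    (h : ∀ y ∈ t, r ≤ dist x y) : r ≤ hausdorffDist s t :=
  ((le_infDist ht).2 fun _ hy => h _ hy).trans <| infDist_le_hausdorffDist_of_mem hx <|
    hausdorffEDist_ne_top_of_nonempty_of_bounded ⟨x, hx⟩ ht (isCompact_univ.isBounded.subset
      (subset_univ _)) (isCompact_univ.isBounded.subset (subset_univ _))

theorem le_dSk {u v : I01 → ℝ} {r : ℝ}
    (h : ∀ (ε : ℝ) (t : ℝ → ℝ), IsHomI t → (∀ x ∈ Icc (0 : ℝ) 1, |t x - x| ≤ ε) →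
      dInfty u (t ∘ v) ≤ ε → r ≤ ε) : r ≤ dSk u v := by
  refine le_csInf ⟨1, one_pos, id, ⟨strictMonoOn_id, continuousOn_id, mapsTo_id _, surjOn_id _⟩,
    by simp, ?_⟩ ?_
  · have : Nonempty (Icc (0 : ℝ) 1) := ⟨0, by simp⟩
    exact ciSup_le fun α => hausdorffDist_I01_le_one _ _
  · rintro ε ⟨-, t, ht, ht', hd⟩
    exact h ε t ht ht' hd

theorem dSk_le {u v : I01 → ℝ} {ε : ℝ} (hε : 0 < ε) {t : ℝ → ℝ} (ht : IsHomI t)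
    (ht' : ∀ x ∈ Icc (0 : ℝ) 1, |t x - x| ≤ ε) (h : dInfty u (t ∘ v) ≤ ε) : dSk u v ≤ ε :=
  csInf_le ⟨0, fun _ hr => hr.1.le⟩ ⟨hε, t, ht, ht', h⟩

theorem fcut_subset_of_pos_imp {w : I01 → ℝ} {a α : ℝ} (hα : 0 ≤ α)
    (h : ∀ x, 0 < w x → a ≤ x.1) : fcut w α ⊆ {x | a ≤ x.1} := by
  unfold fcut
  split_ifs with h0
  · exact closure_minimal h (isClosed_le continuous_const continuous_subtype_val)
  · exact fun x hx => h x ((hα.lt_of_ne' h0).trans_le hx)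

theorem mem_fcut_of_le {X : Type*} [TopologicalSpace X] {w : X → ℝ} {α : ℝ} {x : X}
    (h : α ≤ w x) (h0 : 0 < w x) : x ∈ fcut w α := by
  unfold fcut
  split_ifs
  · exact subset_closure h0
  · exact h

theorem IsHomI.map_one {t : ℝ → ℝ} (ht : IsHomI t) : t 1 = 1 := by
  obtain ⟨y, hy, h⟩ := ht.2.2.2 (show (1 : ℝ) ∈ Icc (0 : ℝ) 1 by simp)
  exact (ht.2.2.1 (by simp)).2.antisymm
    (h.symm.trans_le (ht.1.monotoneOn hy (by simp) hy.2))

theorem IsHomI.map_zero {t : ℝ → ℝ} (ht : IsHomI t) : t 0 = 0 := by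
  obtain ⟨y, hy, h⟩ := ht.2.2.2 (show (0 : ℝ) ∈ Icc (0 : ℝ) 1 by simp)
  exact ((ht.1.monotoneOn (by simp) hy hy.1).trans_eq h).antisymm (ht.2.2.1 (by simp)).1

theorem IsHomI.map_pos {t : ℝ → ℝ} (ht : IsHomI t) {x : ℝ} (hx : x ∈ Icc (0 : ℝ) 1)
    (h0 : 0 < x) : 0 < t x :=
  ht.map_zero ▸ ht.1 (by simp) hx h0

/-- The piecewise linear homeomorphism of `[0,1]` with vertices `0 ↦ 0`, `1/8 ↦ 3/8`, `1 ↦ 1`. -/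
def tEx (x : ℝ) : ℝ := min (3 * x) ((5 * x + 2) / 7)

theorem isHomI_tEx : IsHomI tEx := by
  have hmono : StrictMono tEx := fun x y h =>
    lt_min ((min_le_left _ _).trans_lt (by linarith)) ((min_le_right _ _).trans_lt (by linarith))
  have hcont : Continuous tEx := by unfold tEx; fun_prop
  have h0 : tEx 0 = 0 := by norm_num [tEx]
  have h1 : tEx 1 = 1 := by norm_num [tEx]
  refine ⟨hmono.strictMonoOn _, hcont.continuousOn, fun x hx => ?_, ?_⟩
  · exact ⟨h0 ▸ hmono.monotone hx.1, h1 ▸ hmono.monotone hx.2⟩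
  · have h := intermediate_value_Icc zero_le_one hcont.continuousOn (f := tEx)
    rwa [h0, h1] at h

theorem abs_tEx_sub_le {x : ℝ} (hx : x ∈ Icc (0 : ℝ) 1) : |tEx x - x| ≤ 1 / 4 := by
  obtain ⟨hx0, hx1⟩ := hx
  unfold tEx
  rw [abs_le]
  rcases min_cases (3 * x) ((5 * x + 2) / 7) with h | h <;> constructor <;> linarith

theorem dInfty_uEx_tEx_vEx_le : dInfty uEx (tEx ∘ vEx) ≤ 1 / 4 := by
  have : Nonempty (Icc (0 : ℝ) 1) := ⟨0, by simp⟩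
  have ht8 : tEx (1 / 8) = 3 / 8 := by norm_num [tEx]
  have hvpos : ∀ x : I01, 0 < tEx (vEx x) → 0 < vAux x.1 := fun x hx => by
    refine (vAux_mem x.1).1.lt_of_ne' fun h => ?_
    rw [vEx, h, isHomI_tEx.map_zero] at hx
    exact hx.false
  have hu1 : uEx 1 = 1 := uAux_one
  have hv1 : tEx (vEx 1) = 1 := (congrArg tEx vAux_one).trans isHomI_tEx.map_one
  refine ciSup_le fun ⟨α, hα0, hα1⟩ => ?_
  by_cases hα : α ≤ 3 / 8
  · refine hausdorffDist_le_of_mem_dist (by norm_num) (fun x hx => ⟨x, ?_, by simp⟩)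
      fun x hx => ?_
    · have hx' : 3 / 8 ≤ x.1 := fcut_subset_of_pos_imp hα0 (fun x => le_of_uAux_pos) hx
      have h : 3 / 8 ≤ (tEx ∘ vEx) x := ht8 ▸ isHomI_tEx.1.monotoneOn (by norm_num) (vAux_mem _)
        (le_vAux (by linarith) x.2.2)
      exact mem_fcut_of_le (hα.trans h) (by linarith)
    · have hx' : 1 / 8 ≤ x.1 :=
        fcut_subset_of_pos_imp hα0 (fun x h => le_of_vAux_pos (hvpos x h)) hx
      have hy : max x.1 (3 / 8) ∈ Icc (0 : ℝ) 1 :=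
        ⟨x.2.1.trans (le_max_left _ _), max_le x.2.2 (by norm_num)⟩
      have h : 3 / 8 ≤ uEx ⟨_, hy⟩ := le_uAux (le_max_right _ _) hy.2
      refine ⟨⟨_, hy⟩, mem_fcut_of_le (hα.trans h) (by linarith), ?_⟩
      rw [Subtype.dist_eq, Real.dist_eq, abs_le]
      rcases max_cases x.1 (3 / 8) with h | h <;> constructor <;> linarith
  · have hα' : α ≠ 0 := by linarith
    have hdist : ∀ x : I01, 7 / 8 ≤ x.1 → dist x 1 ≤ 1 / 4 := fun x hx => by
      rw [Subtype.dist_eq, Real.dist_eq, abs_le]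
      have := x.2.2
      constructor <;> push_cast <;> linarith
    refine hausdorffDist_le_of_mem_dist (by norm_num)
      (fun x hx => ⟨1, mem_fcut_of_le (by simpa [hv1]) (by simp [hv1]), hdist x ?_⟩)
      (fun x hx => ⟨1, mem_fcut_of_le (by simpa [hu1]) (by simp [hu1]), hdist x ?_⟩)
    all_goals
      simp only [fcut, if_neg hα', mem_ofPred_eq] at hx
    · exact le_of_lt_uAux ((not_le.1 hα).trans_le hx)
    · refine le_of_lt_vAux ((isHomI_tEx.1.lt_iff_lt (by norm_num) (vAux_mem _)).1 ?_)
      rw [ht8]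
      exact (not_le.1 hα).trans_le hx

theorem dSk_uEx_vEx : dSk uEx vEx = 1 / 4 := by
  refine (dSk_le (by norm_num) isHomI_tEx (fun x => abs_tEx_sub_le)
    dInfty_uEx_tEx_vEx_le).antisymm (le_dSk fun ε t ht _ hd => le_trans ?_ hd)
  refine le_trans ?_ (hausdorffDist_le_dInfty uEx (t ∘ vEx) (α := 0) (by simp))
  rw [hausdorffDist_comm]
  have h8 : (1 / 8 : ℝ) ∈ Icc (0 : ℝ) 1 := by norm_num
  have hv : 0 < t (vEx ⟨1 / 8, h8⟩) :=
    ht.map_pos (vAux_mem _) ((by norm_num : (0 : ℝ) < 1 / 8).trans_le (le_vAux le_rfl h8.2))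
  have hu : (0 : ℝ) < uEx 1 := one_pos.trans_eq uAux_one.symm
  refine le_hausdorffDist_I01 (mem_fcut_of_le hv.le hv) ⟨1, mem_fcut_of_le hu.le hu⟩ fun y hy => ?_
  have hy' : 3 / 8 ≤ y.1 := fcut_subset_of_pos_imp le_rfl (fun x => le_of_uAux_pos) hy
  rw [Subtype.dist_eq, Real.dist_eq, le_abs]
  right
  linarith

theorem le_zadeh {X : Type*} {f : X → X} {w : X → ℝ} (hw : ∀ x, w x ≤ 1) (z : X) :
    w z ≤ zadeh f w (f z) :=
  le_csSup ⟨1, by rintro _ ⟨x, -, rfl⟩; exact hw x⟩ ⟨z, rfl, rfl⟩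

theorem exists_of_lt_zadeh {X : Type*} {f : X → X} {w : X → ℝ} {x : X} {r : ℝ} (hr : 0 ≤ r)
    (h : r < zadeh f w x) : ∃ z, f z = x ∧ r < w z := by
  rcases (w '' (f ⁻¹' {x})).eq_empty_or_nonempty with he | hne
  · rw [zadeh, he, Real.sSup_empty] at h
    linarith
  · obtain ⟨_, ⟨z, hz, rfl⟩, hlt⟩ := exists_lt_of_lt_csSup hne h
    exact ⟨z, hz, hlt⟩

theorem zadeh_mem {X : Type*} {f : X → X} {w : X → ℝ} (hw : ∀ x, w x ∈ Icc (0 : ℝ) 1) (x : X) :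
    zadeh f w x ∈ Icc (0 : ℝ) 1 :=
  ⟨Real.sSup_nonneg (by rintro _ ⟨z, -, rfl⟩; exact (hw z).1),
    Real.sSup_le (by rintro _ ⟨z, -, rfl⟩; exact (hw z).2) zero_le_one⟩

theorem FEx_mem {w : I01 → ℝ} (hw : ∀ x, w x ∈ Icc (0 : ℝ) 1) (x : I01) :
    FEx w x ∈ Icc (0 : ℝ) 1 :=
  ⟨(zadeh_mem hw x).1.trans (le_max_left _ _), max_le (zadeh_mem hw x).2 (zadeh_mem hw x).2⟩

theorem le_of_lt_FEx_vEx {x : I01} (hx : 1 / 8 < FEx vEx x) : 7 / 16 ≤ x.1 := by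
  rcases lt_max_iff.1 hx with h | h <;>
    obtain ⟨z, rfl, hz⟩ := exists_of_lt_zadeh (by norm_num) h <;>
    have hz' := le_of_lt_vAux hz
  · change 7 / 16 ≤ z.1 / 2
    linarith
  · change 7 / 16 ≤ 3 * z.1 / 4
    linarith

theorem le_dSk_FEx : 1 / 4 ≤ dSk (FEx uEx) (FEx vEx) := by
  refine le_dSk fun ε t ht htε hd => ?_
  by_contra! hε
  refine hε.not_ge (le_trans ?_ hd)
  have ht8 : t (1 / 8) < 3 / 8 := by
    have := (abs_le.1 (htε (1 / 8) (by norm_num))).2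
    linarith
  have h38 : (3 / 8 : ℝ) ∈ Icc (0 : ℝ) 1 := by norm_num
  refine le_trans ?_ (hausdorffDist_le_dInfty (FEx uEx) (t ∘ FEx vEx) h38)
  have hu : 3 / 8 ≤ FEx uEx (f1Ex ⟨3 / 8, h38⟩) :=
    (le_uAux le_rfl h38.2).trans <|
      (le_zadeh (f := f1Ex) (fun x => (uAux_mem x.1).2) ⟨3 / 8, h38⟩).trans (le_max_left _ _)
  have hv : FEx vEx (f1Ex 1) = 1 :=
    (FEx_mem (fun x => vAux_mem x.1) _).2.antisymm <| vAux_one.symm.trans_le <|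
      (le_zadeh (f := f1Ex) (fun x => (vAux_mem x.1).2) (1 : I01)).trans (le_max_left _ _)
  have htv : (t ∘ FEx vEx) (f1Ex 1) = 1 := (congrArg t hv).trans ht.map_one
  refine le_hausdorffDist_I01 (mem_fcut_of_le hu (by linarith))
    ⟨f1Ex 1, mem_fcut_of_le (by rw [htv]; norm_num) (by rw [htv]; norm_num)⟩ fun y hy => ?_
  rw [fcut, if_neg (by norm_num)] at hy
  have hy' : 7 / 16 ≤ y.1 := le_of_lt_FEx_vEx <|
    (ht.1.lt_iff_lt (by norm_num) (FEx_mem (fun x => vAux_mem x.1) y)).1 (ht8.trans_le hy)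
  rw [Subtype.dist_eq, Real.dist_eq, le_abs]
  right
  change 1 / 4 ≤ -((3 / 8 : ℝ) / 2 - y.1)
  linarith

theorem fcut_FEx (w : I01 → ℝ) (α : ℝ) :
    fcut (FEx w) α = fcut (zadeh f1Ex w) α ∪ fcut (zadeh f2Ex w) α := by
  unfold fcut FEx
  split_ifs
  · simp only [lt_max_iff, ofPred_or, closure_union]
  · simp only [le_max_iff, ofPred_or]

/-- `[F(w)]_α = [f̃₁(w)]_α ∪ [f̃₂(w)]_α` for all `α ∈ [0,1]`, and for the Example's `u`, `v`
one has `d_0(F(u), F(v)) ≥ 1/4 = d_0(u, v)`; in particular `F` is not a contraction on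
`(𝔉(I), d_0)`. -/
theorem statement13 :
    (∀ w : I01 → ℝ, ∀ α ∈ Icc (0 : ℝ) 1,
      fcut (FEx w) α = fcut (zadeh f1Ex w) α ∪ fcut (zadeh f2Ex w) α) ∧
    1 / 4 ≤ dSk (FEx uEx) (FEx vEx) ∧
    dSk uEx vEx = 1 / 4 ∧
    ¬ ∃ μ : ℝ, 0 ≤ μ ∧ μ < 1 ∧ ∀ u v : I01 → ℝ, IsFuzzy u → IsFuzzy v →
      dSk (FEx u) (FEx v) ≤ μ * dSk u v := by
  refine ⟨fun w α _ => fcut_FEx w α, le_dSk_FEx, dSk_uEx_vEx, ?_⟩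
  rintro ⟨μ, -, hμ, h⟩
  have h' := le_dSk_FEx.trans (h uEx vEx isFuzzy_uEx isFuzzy_vEx)
  rw [dSk_uEx_vEx] at h'
  linarith
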